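/- (Theorem 1: the variational posterior respects the factorization of the exact posterior.) Consider the hierarchical chain model, and assume that for every l ∈ {0,…,L} and every (w, x) ∈ Z_l × X the tail function T_l — defined by T_L(w, x) = p_X(w, x) and T_l(w, x) = ∫ p_{l+1}(w, e) · T_{l+1}(f_{l+1}(w, e), x) dμ_{l+1}(e) — satisfies 0 < T_l(w, x) < ∞. Then there exist measurable functions g_l : Z_{l-1} × E_l × X → [0, ∞), l = 1, …, L, such that: (i) ∫ g_l(w, e, x) dμ_l(e) = 1 for every (w, x); and (ii) for all ε = (ε_1,…,ε_L) and x, J(ε, x) = m(x) · ∏_{l=1}^{L} g_l(z_{l-1}(ε), ε_l, x), where m(x) = ∫ J(ε, x) d(μ_1 ⊗ ⋯ ⊗ μ_L)(ε) is the marginal likelihood. That is, the exact posterior density of (ε_1,…,ε_L) given x factorizes as p(ε_1 | x) · ∏_{l=2}^{L} p(ε_l | z_{l-1}, x): each conditional factor depends on the preceding noise variables only through the latent code z_{l-1}, exactly matching the factorization of the self-reflective variational posterior q(ε_1 | 𝒟) ∏_{l=2}^{L} q(ε_l | z_{l-1}, 𝒟). -/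

import Mathlib

open MeasureTheory
open scoped ENNReal NNReal

/-- The latent codes `z_l(ε)` of the hierarchical chain model, defined recursively from the
initial code `z0` by `z_l(ε) = f_l (z_{l-1}(ε)) (ε_l)`. -/
def latentCode {L : ℕ} {E : Fin L → Type*} {Z : Fin (L + 1) → Type*}
    (z0 : Z 0) (f : ∀ l : Fin L, Z l.castSucc → E l → Z l.succ)
    (ε : ∀ l : Fin L, E l) : ∀ l : Fin (L + 1), Z l :=
  fun l => Fin.induction (motive := fun l => Z l) z0 (fun i zi => f i zi (ε i)) l

/-- The tail functions `T_l : Z_l × X → [0, ∞]`, defined by downward recursion: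
`T_L(w, x) = p_X(w, x)` and `T_l(w, x) = ∫ p_{l+1}(w, e) ⬝ T_{l+1}(f_{l+1}(w, e), x) dμ_{l+1}(e)`. -/
noncomputable def tailFn {L : ℕ} {E : Fin L → Type*} [∀ i, MeasurableSpace (E i)]
    {Z : Fin (L + 1) → Type*} {X : Type*}
    (μE : ∀ i, Measure (E i))
    (f : ∀ l : Fin L, Z l.castSucc → E l → Z l.succ)
    (p : ∀ l : Fin L, Z l.castSucc → E l → ℝ≥0)
    (pX : Z (Fin.last L) → X → ℝ≥0) :
    ∀ l : Fin (L + 1), Z l → X → ℝ≥0∞ :=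
  Fin.reverseInduction (motive := fun l => Z l → X → ℝ≥0∞)
    (fun w x => (pX w x : ℝ≥0∞))
    (fun i T w x => ∫⁻ e, (p i w e : ℝ≥0∞) * T (f i w e) x ∂ μE i)

/-- The joint density `J(ε, x) = (∏_{l=1}^{L} p_l(z_{l-1}(ε), ε_l)) ⬝ p_X(z_L(ε), x)` of the
hierarchical chain model. -/
noncomputable def jointDensity {L : ℕ} {E : Fin L → Type*}
    {Z : Fin (L + 1) → Type*} {X : Type*} (z0 : Z 0)
    (f : ∀ l : Fin L, Z l.castSucc → E l → Z l.succ)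
    (p : ∀ l : Fin L, Z l.castSucc → E l → ℝ≥0)
    (pX : Z (Fin.last L) → X → ℝ≥0) (ε : ∀ i, E i) (x : X) : ℝ≥0∞ :=
  (∏ k : Fin L, (p k (latentCode z0 f ε k.castSucc) (ε k) : ℝ≥0∞)) *
    (pX (latentCode z0 f ε (Fin.last L)) x : ℝ≥0∞)

section ChainModel

variable {L : ℕ} {E : Fin L → Type*} {Z : Fin (L + 1) → Type*} {X : Type*}

theorem latentCode_succ (z0 : Z 0) (f : ∀ l : Fin L, Z l.castSucc → E l → Z l.succ)
    (ε : ∀ i, E i) (l : Fin L) :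
    latentCode z0 f ε l.succ = f l (latentCode z0 f ε l.castSucc) (ε l) := by
  simp [latentCode]

variable [∀ i, MeasurableSpace (E i)]

theorem tailFn_last (μE : ∀ i, Measure (E i))
    (f : ∀ l : Fin L, Z l.castSucc → E l → Z l.succ)
    (p : ∀ l : Fin L, Z l.castSucc → E l → ℝ≥0) (pX : Z (Fin.last L) → X → ℝ≥0)
    (w : Z (Fin.last L)) (x : X) : tailFn μE f p pX (Fin.last L) w x = pX w x := by
  simp [tailFn]

theorem tailFn_castSucc (μE : ∀ i, Measure (E i))
    (f : ∀ l : Fin L, Z l.castSucc → E l → Z l.succ)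
    (p : ∀ l : Fin L, Z l.castSucc → E l → ℝ≥0) (pX : Z (Fin.last L) → X → ℝ≥0)
    (l : Fin L) (w : Z l.castSucc) (x : X) :
    tailFn μE f p pX l.castSucc w x =
      ∫⁻ e, (p l w e : ℝ≥0∞) * tailFn μE f p pX l.succ (f l w e) x ∂ μE l := by
  simp [tailFn]

theorem measurable_latentCode [∀ l, MeasurableSpace (Z l)] (z0 : Z 0)
    {f : ∀ l : Fin L, Z l.castSucc → E l → Z l.succ}
    (hf : ∀ l : Fin L, Measurable (fun q : Z l.castSucc × E l => f l q.1 q.2))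
    (l : Fin (L + 1)) : Measurable (fun ε : ∀ i, E i => latentCode z0 f ε l) := by
  induction l using Fin.induction with
  | zero => exact measurable_const
  | succ i ih =>
    simp only [latentCode_succ]
    exact (hf i).comp (ih.prodMk (measurable_pi_apply i))

theorem measurable_jointDensity [∀ l, MeasurableSpace (Z l)] [MeasurableSpace X] (z0 : Z 0)
    {f : ∀ l : Fin L, Z l.castSucc → E l → Z l.succ}
    (hf : ∀ l : Fin L, Measurable (fun q : Z l.castSucc × E l => f l q.1 q.2))
    {p : ∀ l : Fin L, Z l.castSucc → E l → ℝ≥0}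
    (hp : ∀ l : Fin L, Measurable (fun q : Z l.castSucc × E l => p l q.1 q.2))
    {pX : Z (Fin.last L) → X → ℝ≥0}
    (hpX : Measurable (fun q : Z (Fin.last L) × X => pX q.1 q.2)) (x : X) :
    Measurable (fun ε => jointDensity z0 f p pX ε x) := by
  refine (Finset.measurable_fun_prod _ fun k _ => ?_).mul ?_
  · exact ((hp k).comp
      ((measurable_latentCode z0 hf k.castSucc).prodMk (measurable_pi_apply k))).coe_nnreal_ennreal
  · exact (hpX.comp
      ((measurable_latentCode z0 hf (Fin.last L)).prodMk measurable_const)).coe_nnreal_ennreal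

theorem measurable_tailFn [∀ l, MeasurableSpace (Z l)] [MeasurableSpace X]
    (μE : ∀ i, Measure (E i)) [∀ i, SigmaFinite (μE i)]
    {f : ∀ l : Fin L, Z l.castSucc → E l → Z l.succ}
    (hf : ∀ l : Fin L, Measurable (fun q : Z l.castSucc × E l => f l q.1 q.2))
    {p : ∀ l : Fin L, Z l.castSucc → E l → ℝ≥0}
    (hp : ∀ l : Fin L, Measurable (fun q : Z l.castSucc × E l => p l q.1 q.2))
    {pX : Z (Fin.last L) → X → ℝ≥0}
    (hpX : Measurable (fun q : Z (Fin.last L) × X => pX q.1 q.2)) (l : Fin (L + 1)) :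
    Measurable (fun q : Z l × X => tailFn μE f p pX l q.1 q.2) := by
  induction l using Fin.reverseInduction with
  | last =>
    simp only [tailFn_last]
    exact hpX.coe_nnreal_ennreal
  | cast i ih =>
    simp only [tailFn_castSucc]
    have hwe : Measurable (fun r : (Z i.castSucc × X) × E i => (r.1.1, r.2)) := by fun_prop
    exact Measurable.lintegral_prod_right (((hp i).comp hwe).coe_nnreal_ennreal.mul
      (ih.comp (((hf i).comp hwe).prodMk (measurable_snd.comp measurable_fst))))

end ChainModel

section FirstLayer

variable {L : ℕ} {E : Fin (L + 1) → Type*} {Z : Fin (L + 2) → Type*} {X : Type*}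

/-- Removing the first layer of the chain starts it at the first latent code. -/
theorem latentCode_succ_eq_latentCode_tail (z0 : Z 0)
    (f : ∀ l : Fin (L + 1), Z l.castSucc → E l → Z l.succ)
    (ε : ∀ i, E i) (l : Fin (L + 1)) :
    latentCode z0 f ε l.succ =
      latentCode (E := fun i : Fin L => E i.succ) (Z := fun i => Z i.succ)
        (f 0 z0 (ε 0)) (fun i => f i.succ) (fun i => ε i.succ) l := by
  induction l using Fin.induction with
  | zero => exact latentCode_succ z0 f ε 0
  | succ i ih =>
    rw [latentCode_succ, latentCode_succ]
    exact congrArg (fun w => f i.succ w (ε i.succ)) ih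

theorem jointDensity_succ (z0 : Z 0)
    (f : ∀ l : Fin (L + 1), Z l.castSucc → E l → Z l.succ)
    (p : ∀ l : Fin (L + 1), Z l.castSucc → E l → ℝ≥0)
    (pX : Z (Fin.last (L + 1)) → X → ℝ≥0) (ε : ∀ i, E i) (x : X) :
    jointDensity z0 f p pX ε x = p 0 z0 (ε 0) *
      jointDensity (E := fun i : Fin L => E i.succ) (Z := fun i => Z i.succ)
        (f 0 z0 (ε 0)) (fun i => f i.succ) (fun i => p i.succ) pX (fun i => ε i.succ) x := by
  have hlast := latentCode_succ_eq_latentCode_tail z0 f ε (Fin.last L)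
  have hprod : ∀ k : Fin L, p k.succ (latentCode z0 f ε k.succ.castSucc) (ε k.succ) =
      p k.succ (latentCode (E := fun i : Fin L => E i.succ) (Z := fun i => Z i.succ)
        (f 0 z0 (ε 0)) (fun i => f i.succ) (fun i => ε i.succ) k.castSucc) (ε k.succ) :=
    fun k => congrArg (fun w => p k.succ w (ε k.succ))
      (latentCode_succ_eq_latentCode_tail z0 f ε k.castSucc)
  unfold jointDensity
  rw [Fin.prod_univ_succ, mul_assoc]
  congr 2
  · exact Finset.prod_congr rfl fun k _ => congrArg _ (hprod k)
  · exact congrArg (fun w => (pX w x : ℝ≥0∞)) hlast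

theorem tailFn_succ [∀ i, MeasurableSpace (E i)] (μE : ∀ i, Measure (E i))
    (f : ∀ l : Fin (L + 1), Z l.castSucc → E l → Z l.succ)
    (p : ∀ l : Fin (L + 1), Z l.castSucc → E l → ℝ≥0)
    (pX : Z (Fin.last (L + 1)) → X → ℝ≥0) (l : Fin (L + 1)) (w : Z l.succ) (x : X) :
    tailFn μE f p pX l.succ w x =
      tailFn (E := fun i : Fin L => E i.succ) (Z := fun i => Z i.succ)
        (fun i => μE i.succ) (fun i => f i.succ) (fun i => p i.succ) pX l w x := by
  induction l using Fin.reverseInduction with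
  | last => exact (tailFn_last μE f p pX w x).trans (tailFn_last (E := fun i : Fin L => E i.succ)
      (Z := fun i => Z i.succ) (fun i => μE i.succ) (fun i => f i.succ) _ pX w x).symm
  | cast i ih =>
    rw [tailFn_castSucc]
    refine (tailFn_castSucc μE f p pX i.succ w x).trans ?_
    exact lintegral_congr fun e => congrArg _ (ih _)

end FirstLayer

/-- The marginal likelihood is the tail function of layer `0` at the initial code. -/
theorem lintegral_jointDensity {L : ℕ} {E : Fin L → Type*} [∀ i, MeasurableSpace (E i)]
    (μE : ∀ i, Measure (E i)) [∀ i, SigmaFinite (μE i)]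
    {Z : Fin (L + 1) → Type*} [∀ l, MeasurableSpace (Z l)] {X : Type*} [MeasurableSpace X]
    (z0 : Z 0) {f : ∀ l : Fin L, Z l.castSucc → E l → Z l.succ}
    (hf : ∀ l : Fin L, Measurable (fun q : Z l.castSucc × E l => f l q.1 q.2))
    {p : ∀ l : Fin L, Z l.castSucc → E l → ℝ≥0}
    (hp : ∀ l : Fin L, Measurable (fun q : Z l.castSucc × E l => p l q.1 q.2))
    {pX : Z (Fin.last L) → X → ℝ≥0}
    (hpX : Measurable (fun q : Z (Fin.last L) × X => pX q.1 q.2)) (x : X) :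
    ∫⁻ ε, jointDensity z0 f p pX ε x ∂ Measure.pi μE = tailFn μE f p pX 0 z0 x := by
  induction L with
  | zero =>
    have hJ : ∀ ε : ∀ i, E i, jointDensity z0 f p pX ε x = pX z0 x := fun ε => by
      simp only [jointDensity, Finset.univ_eq_empty, Finset.prod_empty, one_mul]
      rfl
    simp only [hJ, lintegral_const, Measure.pi_empty_univ, mul_one]
    exact (tailFn_last μE f p pX z0 x).symm
  | succ L ih =>
    have hJ := measurable_jointDensity z0 hf hp hpX x
    have hmp := (measurePreserving_piFinSuccAbove μE 0).symm
    rw [← hmp.lintegral_comp hJ,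
      lintegral_prod
        (fun q => jointDensity z0 f p pX ((MeasurableEquiv.piFinSuccAbove E 0).symm q) x)
        (hJ.comp hmp.measurable).aemeasurable]
    refine Eq.trans (lintegral_congr fun e => ?_) (tailFn_castSucc μE f p pX 0 z0 x).symm
    have hJe : ∀ ε : ∀ i : Fin L, E i.succ,
        jointDensity z0 f p pX ((MeasurableEquiv.piFinSuccAbove E 0).symm (e, ε)) x =
          p 0 z0 e * jointDensity (E := fun i : Fin L => E i.succ) (Z := fun i => Z i.succ)
            (f 0 z0 e) (fun i => f i.succ) (fun i => p i.succ) pX ε x := fun ε => by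
      have hcons : (MeasurableEquiv.piFinSuccAbove E 0).symm (e, ε) = Fin.cons e ε :=
        Fin.insertNth_zero e ε
      rw [hcons]
      exact jointDensity_succ z0 f p pX (Fin.cons e ε) x
    refine Eq.trans (lintegral_congr hJe) ?_
    refine (lintegral_const_mul' _ _ ENNReal.coe_ne_top).trans ?_
    refine congrArg _ (Eq.trans ?_ (tailFn_succ μE f p pX 0 _ x).symm)
    exact ih (E := fun i => E i.succ) (Z := fun i => Z i.succ) (fun i => μE i.succ)
      (f 0 z0 e) (fun i => hf i.succ) (fun i => hp i.succ) hpX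

theorem ENNReal.mul_prod_mul_succ_div_castSucc {n : ℕ} (a : Fin (n + 1) → ℝ≥0∞)
    (b : Fin n → ℝ≥0∞) (h0 : ∀ i, a i ≠ 0) (htop : ∀ i, a i ≠ ∞) :
    a 0 * ∏ i : Fin n, (b i * a i.succ / a i.castSucc) = (∏ i, b i) * a (Fin.last n) := by
  induction n with
  | zero => simp
  | succ n ih =>
    have h := ih (fun i => a i.castSucc) (fun i => b i.castSucc) (fun i => h0 _) (fun i => htop _)
    rw [Fin.castSucc_zero] at h
    rw [Fin.prod_univ_castSucc, Fin.prod_univ_castSucc, ← mul_assoc]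
    refine (congrArg (· * _) h).trans ?_
    rw [mul_assoc, mul_assoc, ENNReal.mul_div_cancel (h0 _) (htop _), Fin.succ_last]

/-- **Theorem 1: the variational posterior respects the factorization of the exact
posterior.**  In the hierarchical chain model, if all the tail functions `T_l` are
positive and finite, then there exist measurable probability kernels
`g_l : Z_{l-1} × E_l × X → [0, ∞)` such that the joint density factorizes as
`J(ε, x) = m(x) ⬝ ∏_{l=1}^{L} g_l(z_{l-1}(ε), ε_l, x)` where `m` is the marginal
likelihood: the exact posterior of `(ε_1, …, ε_L)` given `x` factorizes as
`p(ε_1 | x) ⬝ ∏_{l=2}^{L} p(ε_l | z_{l-1}, x)`, each factor depending on the preceding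
noise variables only through the latent code `z_{l-1}`, exactly matching the
factorization of the self-reflective variational posterior. -/
theorem exact_posterior_factorization {L : ℕ}
    (E : Fin L → Type*) [∀ i, MeasurableSpace (E i)]
    (μE : ∀ i, Measure (E i)) [∀ i, SigmaFinite (μE i)]
    (Z : Fin (L + 1) → Type*) [∀ l, MeasurableSpace (Z l)] (z0 : Z 0)
    (f : ∀ l : Fin L, Z l.castSucc → E l → Z l.succ)
    (hf : ∀ l : Fin L, Measurable (fun q : Z l.castSucc × E l => f l q.1 q.2))
    (hbij : ∀ (l : Fin L) (w : Z l.castSucc), Function.Bijective (f l w))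
    (p : ∀ l : Fin L, Z l.castSucc → E l → ℝ≥0)
    (hp : ∀ l : Fin L, Measurable (fun q : Z l.castSucc × E l => p l q.1 q.2))
    (hp1 : ∀ (l : Fin L) (w : Z l.castSucc), ∫⁻ e, (p l w e : ℝ≥0∞) ∂ μE l = 1)
    (X : Type*) [MeasurableSpace X] (ν : Measure X) [SigmaFinite ν]
    (pX : Z (Fin.last L) → X → ℝ≥0)
    (hpX : Measurable (fun q : Z (Fin.last L) × X => pX q.1 q.2))
    (hpX1 : ∀ z : Z (Fin.last L), ∫⁻ x, (pX z x : ℝ≥0∞) ∂ ν = 1)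
    (hT : ∀ (l : Fin (L + 1)) (w : Z l) (x : X),
      0 < tailFn μE f p pX l w x ∧ tailFn μE f p pX l w x < ∞) :
    ∃ g : ∀ l : Fin L, Z l.castSucc → E l → X → ℝ≥0,
      (∀ l : Fin L,
        Measurable (fun q : Z l.castSucc × E l × X => g l q.1 q.2.1 q.2.2)) ∧
      (∀ (l : Fin L) (w : Z l.castSucc) (x : X),
        ∫⁻ e, (g l w e x : ℝ≥0∞) ∂ μE l = 1) ∧
      (∀ (ε : ∀ i, E i) (x : X),
        jointDensity z0 f p pX ε x =
          (∫⁻ ε', jointDensity z0 f p pX ε' x ∂ Measure.pi μE) *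
            ∏ l : Fin L, (g l (latentCode z0 f ε l.castSucc) (ε l) x : ℝ≥0∞)) := by
  have h0 l w x : tailFn μE f p pX l w x ≠ 0 := (hT l w x).1.ne'
  have htop l w x : tailFn μE f p pX l w x ≠ ∞ := (hT l w x).2.ne
  have hcoe (l : Fin L) w e x : ((p l w e * tailFn μE f p pX l.succ (f l w e) x /
      tailFn μE f p pX l.castSucc w x).toNNReal : ℝ≥0∞) =
      p l w e * tailFn μE f p pX l.succ (f l w e) x / tailFn μE f p pX l.castSucc w x :=
    ENNReal.coe_toNNReal
      (ENNReal.div_ne_top (ENNReal.mul_ne_top ENNReal.coe_ne_top (htop _ _ _)) (h0 _ _ _))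
  refine ⟨fun l w e x => (p l w e * tailFn μE f p pX l.succ (f l w e) x /
    tailFn μE f p pX l.castSucc w x).toNNReal, fun l => ?_, fun l w x => ?_, fun ε x => ?_⟩
  · have hwe : Measurable (fun q : Z l.castSucc × E l × X => (q.1, q.2.1)) := by fun_prop
    have hx : Measurable (fun q : Z l.castSucc × E l × X => q.2.2) := by fun_prop
    exact ((((hp l).comp hwe).coe_nnreal_ennreal.mul
      ((measurable_tailFn μE hf hp hpX l.succ).comp (((hf l).comp hwe).prodMk hx))).div
      ((measurable_tailFn μE hf hp hpX l.castSucc).comp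
        (measurable_fst.prodMk hx))).ennreal_toNNReal
  · simp only [hcoe]
    simp only [div_eq_mul_inv]
    rw [lintegral_mul_const' _ _ (ENNReal.inv_ne_top.2 (h0 _ _ _)), ← tailFn_castSucc,
      ENNReal.mul_inv_cancel (h0 _ _ _) (htop _ _ _)]
  · simp only [hcoe]
    simp only [← latentCode_succ]
    rw [lintegral_jointDensity μE z0 hf hp hpX]
    refine Eq.trans ?_ (ENNReal.mul_prod_mul_succ_div_castSucc
      (fun l => tailFn μE f p pX l (latentCode z0 f ε l) x) _
      (fun l => h0 _ _ _) (fun l => htop _ _ _)).symm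
    rw [tailFn_last, jointDensity]
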